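/- Let u be a viscosity solution of λ (det D²u)^p ≤ u_t ≤ Λ (det D²u)^p in Ω × [−T,0] with 0 ∈ Ω. Assume u(0,t) = 0 for all t ∈ [−δ,0] for some δ ∈ (0,T), and that there exist h₀ > 0 and q ∈ ℝⁿ such that the section S_{h₀} := {x ∈ Ω : u(x,0) < h₀ + q·x} has compact closure contained in Ω. Then u(0,t) = 0 for all t ∈ [−T,0]. -/

import Mathlib

open Set Metric MeasureTheory
open scoped RealInnerProductSpace

noncomputable section

abbrev E (n : ℕ) := EuclideanSpace ℝ (Fin n)

variable {n : ℕ}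

/-- The time derivative `∂ₜφ(x,t)`. -/
noncomputable def timeDeriv (φ : E n → ℝ → ℝ) (x : E n) (t : ℝ) : ℝ :=
  deriv (φ x) t

/-- The spatial Hessian matrix `D²φ(x,t)` (in the standard coordinates). -/
noncomputable def hessMatrix (φ : E n → ℝ → ℝ) (x : E n) (t : ℝ) :
    Matrix (Fin n) (Fin n) ℝ :=
  Matrix.of fun i j =>
    fderiv ℝ (fun y => fderiv ℝ (fun z => φ z t) y (EuclideanSpace.single j (1:ℝ))) x
      (EuclideanSpace.single i (1:ℝ))

/-- `φ` is an admissible test function near `(x₀,t₀)`: C² in `x` and C¹ in `t` nearby. -/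
def IsTestAt (φ : E n → ℝ → ℝ) (x₀ : E n) (t₀ : ℝ) : Prop :=
  ∃ ε > (0:ℝ),
    (∀ t ∈ ball t₀ ε, ContDiffOn ℝ 2 (fun x => φ x t) (ball x₀ ε)) ∧
    (∀ x ∈ ball x₀ ε, ContDiffOn ℝ 1 (fun t => φ x t) (ball t₀ ε))

/-- `u - φ` attains a local maximum at `(x₀,t₀)` among times `t ≤ t₀`,
relative to `closure Ω × [t₁,t₂]`. -/
def LocalMaxBelow (Ω : Set (E n)) (t₁ t₂ : ℝ) (u φ : E n → ℝ → ℝ)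
    (x₀ : E n) (t₀ : ℝ) : Prop :=
  ∃ ε > (0:ℝ), ∀ x ∈ closure Ω, ∀ t ∈ Icc t₁ t₂, t ≤ t₀ →
    dist x x₀ < ε → dist t t₀ < ε →
    u x t - φ x t ≤ u x₀ t₀ - φ x₀ t₀

/-- `u - φ` attains a local minimum at `(x₀,t₀)` among times `t ≤ t₀`. -/
def LocalMinBelow (Ω : Set (E n)) (t₁ t₂ : ℝ) (u φ : E n → ℝ → ℝ)
    (x₀ : E n) (t₀ : ℝ) : Prop :=
  ∃ ε > (0:ℝ), ∀ x ∈ closure Ω, ∀ t ∈ Icc t₁ t₂, t ≤ t₀ →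
    dist x x₀ < ε → dist t t₀ < ε →
    u x₀ t₀ - φ x₀ t₀ ≤ u x t - φ x t

/-- Viscosity subsolution of `u_t ≤ Λ (det D²u)^p` on `Ω × [t₁,t₂]`. -/
def ViscSubsolution (Lam p : ℝ) (Ω : Set (E n)) (t₁ t₂ : ℝ) (u : E n → ℝ → ℝ) : Prop :=
  ∀ x₀ ∈ Ω, ∀ t₀ ∈ Ioc t₁ t₂, ∀ φ : E n → ℝ → ℝ, IsTestAt φ x₀ t₀ →
    LocalMaxBelow Ω t₁ t₂ u φ x₀ t₀ →
    timeDeriv φ x₀ t₀ ≤ Lam * max (hessMatrix φ x₀ t₀).det 0 ^ p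

/-- Viscosity supersolution of `u_t ≥ λ (det D²u)^p` on `Ω × [t₁,t₂]`. -/
def ViscSupersolution (lam p : ℝ) (Ω : Set (E n)) (t₁ t₂ : ℝ) (u : E n → ℝ → ℝ) : Prop :=
  ∀ x₀ ∈ Ω, ∀ t₀ ∈ Ioc t₁ t₂, ∀ φ : E n → ℝ → ℝ, IsTestAt φ x₀ t₀ →
    LocalMinBelow Ω t₁ t₂ u φ x₀ t₀ →
    (hessMatrix φ x₀ t₀).PosSemidef →
    lam * (hessMatrix φ x₀ t₀).det ^ p ≤ timeDeriv φ x₀ t₀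

/-- The regularity/structure assumptions: continuity on `closure Ω × [t₁,t₂]`,
convexity in `x`, monotonicity in `t`. -/
structure ParabolicRegular (Ω : Set (E n)) (t₁ t₂ : ℝ) (u : E n → ℝ → ℝ) : Prop where
  cont : ContinuousOn (fun q : E n × ℝ => u q.1 q.2) (closure Ω ×ˢ Icc t₁ t₂)
  conv : ∀ t ∈ Icc t₁ t₂, ConvexOn ℝ (closure Ω) (fun x => u x t)
  mono : ∀ x ∈ closure Ω, ∀ s ∈ Icc t₁ t₂, ∀ t ∈ Icc t₁ t₂, s ≤ t → u x s ≤ u x t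

/-- Viscosity solution of `λ (det D²u)^p ≤ u_t ≤ Λ (det D²u)^p` on `Ω × [t₁,t₂]`. -/
def ViscositySolution (lam Lam p : ℝ) (Ω : Set (E n)) (t₁ t₂ : ℝ) (u : E n → ℝ → ℝ) : Prop :=
  ParabolicRegular Ω t₁ t₂ u ∧ ViscSubsolution Lam p Ω t₁ t₂ u ∧
    ViscSupersolution lam p Ω t₁ t₂ u

/-- `w` is `C^{1,α}` at `x₀` (relative to the set `D`) with some finite constant. -/
def C1AlphaAt (w : E n → ℝ) (D : Set (E n)) (α : ℝ) (x₀ : E n) : Prop :=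
  ∃ C a : ℝ, ∃ q : E n, ∀ x ∈ D, |w x - (a + ⟪q, x - x₀⟫)| ≤ C * ‖x - x₀‖ ^ (1 + α)

/-- `w` is `C^{1,α}` at `x₀` in the direction `e` (relative to the set `D`). -/
def C1AlphaDirAt (w : E n → ℝ) (D : Set (E n)) (α : ℝ) (x₀ e : E n) : Prop :=
  ∃ C a q : ℝ, ∀ s : ℝ, x₀ + s • e ∈ D →
    |w (x₀ + s • e) - (a + q * s)| ≤ C * |s| ^ (1 + α)

/-- A convex set `S` is `d`-balanced with respect to `x₀`. -/
def DBalanced (d : ℝ) (S : Set (E n)) (x₀ : E n) : Prop :=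
  ∃ A : E n →ₗ[ℝ] E n, Function.Bijective A ∧
    ball (0 : E n) 1 ⊆ A '' ((fun y => y - x₀) '' S) ∧
    A '' ((fun y => y - x₀) '' S) ⊆ ball (0 : E n) d

/-- `x₀` is an extremal point of the convex set `D`. -/
def ExtremalPoint (D : Set (E n)) (x₀ : E n) : Prop :=
  ¬ ∃ y ∈ closure D, ∃ z ∈ closure D, ∃ t : ℝ,
      0 < t ∧ t < 1 ∧ y ≠ z ∧ x₀ = t • y + (1 - t) • z

/-- A convex function on the closure of an open convex set has a subgradient at interior points. -/
lemma exists_subgradient {Ω : Set (E n)} (hΩo : IsOpen Ω)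
    {f : E n → ℝ} (hf : ContinuousOn f (closure Ω)) (hfc : ConvexOn ℝ (closure Ω) f)
    (hΩc : Convex ℝ Ω) {x₀ : E n} (hx₀ : x₀ ∈ Ω) :
    ∃ ζ : E n, ∀ x ∈ closure Ω, f x₀ + ⟪ζ, x - x₀⟫ ≤ f x := by
  have hfΩ : ConvexOn ℝ Ω f := hfc.subset subset_closure hΩc
  have hopen : IsOpen {p : E n × ℝ | p.1 ∈ Ω ∧ f p.1 < p.2} := by
    have h1 : ContinuousOn (fun p : E n × ℝ => p.2 - f p.1) (Prod.fst ⁻¹' Ω) :=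
      continuousOn_snd.sub ((hf.mono subset_closure).comp continuousOn_fst fun p hp => hp)
    have h2 := h1.isOpen_inter_preimage (hΩo.preimage continuous_fst) (isOpen_Ioi (a := (0 : ℝ)))
    convert h2 using 1
    ext p
    simp
  obtain ⟨L, hL⟩ := geometric_hahn_banach_open_point hfΩ.convex_strict_epigraph hopen
    (x := (x₀, f x₀)) (by simp)
  have hsplit : ∀ x s, L (x, s) = L (x, 0) + s * L (0, 1) := by
    intro x s
    have : ((x, s) : E n × ℝ) = (x, 0) + s • (0, 1) := by simp
    rw [this, map_add, map_smul, smul_eq_mul]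
  set c := L (0, 1) with hc
  have hcneg : c < 0 := by
    have := hL (x₀, f x₀ + 1) ⟨hx₀, by simp⟩
    rw [hsplit x₀ (f x₀ + 1), hsplit x₀ (f x₀)] at this
    linarith
  let ℓ : E n →L[ℝ] ℝ := L.comp (ContinuousLinearMap.inl ℝ (E n) ℝ)
  have hℓ : ∀ x, L (x, 0) = ℓ x := fun x => rfl
  have hΩineq : ∀ x ∈ Ω, ℓ x + f x * c ≤ ℓ x₀ + f x₀ * c := by
    intro x hx
    refine le_of_forall_pos_lt_add fun ε hε => ?_
    have hpos : 0 < ε / (-c) := div_pos hε (by linarith)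
    have := hL (x, f x + ε / (-c)) ⟨hx, by simpa using hpos⟩
    rw [hsplit x, hsplit x₀, hℓ, hℓ] at this
    have h3 : ε / (-c) * c = -ε := by
      field_simp [hcneg.ne]
    nlinarith
  refine ⟨(InnerProductSpace.toDual ℝ (E n)).symm ((-c)⁻¹ • ℓ), fun x hx => ?_⟩
  have hcl : ℓ x + f x * c ≤ ℓ x₀ + f x₀ * c := by
    have hcont : ContinuousOn (fun x => ℓ x + f x * c) (closure Ω) :=
      ℓ.continuous.continuousOn.add (hf.mul continuousOn_const)
    exact ContinuousWithinAt.closure_le hx ((hcont x hx).mono subset_closure)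
      continuousWithinAt_const hΩineq
  rw [InnerProductSpace.toDual_symm_apply]
  simp only [smul_apply, map_sub, smul_eq_mul]
  have hc' : 0 < -c := by linarith
  rw [← le_sub_iff_add_le', ← mul_sub, inv_mul_le_iff₀ hc']
  nlinarith

/-- Among tuples in a compact set of slopes that contains a ball, one of maximal determinant is a
basis in which all the slopes of the set have coordinates bounded by one. -/
lemma exists_dominating_basis {G : Set (E n)} (hG : IsCompact G) {r : ℝ} (hr : 0 < r)
    (hball : closedBall 0 r ⊆ G) :
    ∃ ξ : Fin n → E n, (∀ k, ξ k ∈ G) ∧ (Matrix.of fun k i => ξ k i).det ≠ 0 ∧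
      ∀ ζ ∈ G, ∀ x : E n, |⟪ζ, x⟫| ≤ ∑ k, |⟪ξ k, x⟫| := by
  have hcpt : IsCompact (Set.pi univ fun _ : Fin n => G) := isCompact_univ_pi fun _ => hG
  have hcont : Continuous fun ξ : Fin n → E n => |(Matrix.of fun k i => ξ k i).det| := by
    refine (Continuous.matrix_det ?_).abs
    refine continuous_pi fun k => continuous_pi fun i => ?_
    simp only [Matrix.of_apply]
    fun_prop
  let ξ₀ : Fin n → E n := fun k => EuclideanSpace.single k r
  have hξ₀ : ξ₀ ∈ Set.pi univ fun _ : Fin n => G := by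
    intro k _
    apply hball
    simp [ξ₀, abs_of_pos hr]
  obtain ⟨ξ, hξ, hmax⟩ := hcpt.exists_isMaxOn ⟨ξ₀, hξ₀⟩ hcont.continuousOn
  have hdet₀ : (Matrix.of fun k i => ξ₀ k i).det = r ^ n := by
    have : (Matrix.of fun k i => ξ₀ k i) = Matrix.diagonal fun _ : Fin n => r := by
      ext k i
      simp [ξ₀, Matrix.diagonal_apply, eq_comm]
    rw [this, Matrix.det_diagonal]
    simp
  have hdet : (Matrix.of fun k i => ξ k i).det ≠ 0 := by
    have h1 := hmax hξ₀
    simp only [mem_ofPred_eq, hdet₀] at h1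
    have h2 : 0 < |r ^ n| := abs_pos.2 (pow_pos hr n).ne'
    exact abs_pos.1 (h2.trans_le h1)
  refine ⟨ξ, fun k => hξ k trivial, hdet, fun ζ hζ x => ?_⟩
  set X : Matrix (Fin n) (Fin n) ℝ := Matrix.of fun k i => ξ k i with hX
  have hcr : ∀ k, |X.transpose.cramer ζ.ofLp k| ≤ |X.det| := by
    intro k
    rw [Matrix.cramer_transpose_apply]
    have hmem : Function.update ξ k ζ ∈ Set.pi univ fun _ : Fin n => G := by
      intro j _
      by_cases hj : j = k
      · subst hj; simpa using hζ
      · simpa [hj] using hξ j trivial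
    have h1 := hmax hmem
    simp only [mem_ofPred_eq] at h1
    have h2 : X.updateRow k ζ.ofLp =
        Matrix.of fun j i => (Function.update ξ k ζ j).ofLp i := by
      ext j i
      by_cases hj : j = k
      · subst hj; simp
      · simp [hj, hX]
    rwa [h2]
  have hsum : X.det * ⟪ζ, x⟫ = ∑ k, X.transpose.cramer ζ.ofLp k * ⟪ξ k, x⟫ := by
    have h1 := Matrix.mulVec_cramer X.transpose ζ.ofLp
    rw [Matrix.det_transpose] at h1
    have h2 : ∀ i, X.det * ζ i = ∑ k, X.transpose.cramer ζ.ofLp k * ξ k i := by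
      intro i
      have := congrFun h1 i
      simp only [Matrix.mulVec, dotProduct, Matrix.transpose_apply, Pi.smul_apply, smul_eq_mul,
        hX, Matrix.of_apply] at this
      rw [← this]
      exact Finset.sum_congr rfl fun k _ => mul_comm _ _
    simp only [PiLp.inner_apply, RCLike.inner_apply, conj_trivial, Finset.mul_sum]
    rw [Finset.sum_comm]
    refine Finset.sum_congr rfl fun i _ => ?_
    rw [mul_left_comm, h2, Finset.mul_sum]
    exact Finset.sum_congr rfl fun k _ => by ring
  have hpos : 0 < |X.det| := abs_pos.2 hdet
  refine le_of_mul_le_mul_left ?_ hpos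
  calc |X.det| * |⟪ζ, x⟫| = |∑ k, X.transpose.cramer ζ.ofLp k * ⟪ξ k, x⟫| := by
        rw [← abs_mul, hsum]
    _ ≤ ∑ k, |X.transpose.cramer ζ.ofLp k * ⟪ξ k, x⟫| := Finset.abs_sum_le_sum_abs _ _
    _ ≤ ∑ k, |X.det| * |⟪ξ k, x⟫| := by
        refine Finset.sum_le_sum fun k _ => ?_
        rw [abs_mul]
        exact mul_le_mul_of_nonneg_right (hcr k) (abs_nonneg _)
    _ = |X.det| * ∑ k, |⟪ξ k, x⟫| := by rw [Finset.mul_sum]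

/-- The slopes of the affine functions of height `-h` at the origin that lie below `f` on `D`. -/
def slopeSet (D : Set (E n)) (f : E n → ℝ) (h : ℝ) : Set (E n) :=
  {ξ | ∀ x ∈ D, ⟪ξ, x⟫ - h ≤ f x}

lemma isCompact_slopeSet {Ω : Set (E n)} (hΩo : IsOpen Ω) (hΩb : Bornology.IsBounded Ω)
    (h0 : (0 : E n) ∈ Ω) {f : E n → ℝ} (hf : ContinuousOn f (closure Ω)) (h : ℝ) :
    IsCompact (slopeSet (closure Ω) f h) := by
  refine isCompact_of_isClosed_isBounded ?_ ?_
  · have : slopeSet (closure Ω) f h = ⋂ x ∈ closure Ω, {ξ | ⟪ξ, x⟫ - h ≤ f x} := by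
      ext ξ
      simp [slopeSet]
    rw [this]
    exact isClosed_biInter fun x _ => isClosed_le (by fun_prop) continuous_const
  · obtain ⟨r, hr, hball⟩ := nhds_basis_closedBall.mem_iff.1 (hΩo.mem_nhds h0)
    obtain ⟨F, hF⟩ := (hΩb.isCompact_closure.image_of_continuousOn hf).bddAbove
    refine (isBounded_iff_forall_norm_le).2 ⟨(h + F) / r, fun ξ hξ => ?_⟩
    rw [le_div_iff₀ hr]
    rcases eq_or_ne ξ 0 with rfl | hne
    · have h1 := hξ 0 (subset_closure h0)
      have h2 := hF ⟨0, subset_closure h0, rfl⟩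
      simp only [inner_zero_left] at h1
      simp only [norm_zero, zero_mul]
      linarith
    · have hn : 0 < ‖ξ‖ := norm_pos_iff.2 hne
      have hx : (r / ‖ξ‖) • ξ ∈ closure Ω := by
        refine subset_closure (hball ?_)
        rw [mem_closedBall_zero_iff, norm_smul, Real.norm_of_nonneg (by positivity)]
        field_simp
        exact le_rfl
      have h1 := hξ _ hx
      have h2 := hF ⟨_, hx, rfl⟩
      rw [inner_smul_right, real_inner_self_eq_norm_sq] at h1
      have h3 : r / ‖ξ‖ * ‖ξ‖ ^ 2 = ‖ξ‖ * r := by field_simp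
      rw [h3] at h1
      linarith

lemma closedBall_subset_slopeSet {D : Set (E n)} {f : E n → ℝ} {h M : ℝ} (hM : 0 < M)
    (hh : 0 ≤ h) (hD : D ⊆ closedBall 0 M) (hf : ∀ x ∈ D, 0 ≤ f x) :
    closedBall 0 (h / M) ⊆ slopeSet D f h := by
  intro ξ hξ x hx
  rw [mem_closedBall_zero_iff] at hξ
  have hx' : ‖x‖ ≤ M := mem_closedBall_zero_iff.1 (hD hx)
  have h1 := real_inner_le_norm ξ x
  have h2 : ‖ξ‖ * ‖x‖ ≤ h / M * M := mul_le_mul hξ hx' (norm_nonneg _) (by positivity)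
  rw [div_mul_cancel₀ _ hM.ne'] at h2
  linarith [hf x hx]

/-- A point at which all the slopes of `slopeSet` pair to less than `h` lies in the domain. -/
lemma mem_of_inner_slopeSet_lt {Ω : Set (E n)} (hΩo : IsOpen Ω) (hΩc : Convex ℝ Ω)
    (h0 : (0 : E n) ∈ Ω) {f : E n → ℝ} (hf0 : ∀ x ∈ closure Ω, 0 ≤ f x) {h : ℝ} (hh : 0 < h)
    {x₀ : E n} (hx₀ : ∀ ζ ∈ slopeSet (closure Ω) f h, ⟪ζ, x₀⟫ < h) : x₀ ∈ Ω := by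
  by_contra hx
  obtain ⟨L, hL⟩ := geometric_hahn_banach_open_point hΩc hΩo hx
  have hpos : 0 < L x₀ := by simpa using hL 0 h0
  let e : E n := (InnerProductSpace.toDual ℝ (E n)).symm L
  have he : ∀ x, ⟪e, x⟫ = L x := fun x => InnerProductSpace.toDual_symm_apply
  have hmem : (h / L x₀) • e ∈ slopeSet (closure Ω) f h := by
    intro x hx
    have h1 : L x ≤ L x₀ := ContinuousWithinAt.closure_le hx L.continuous.continuousWithinAt
      continuousWithinAt_const fun y hy => (hL y hy).le
    rw [real_inner_smul_left, he]
    have h2 : h / L x₀ * L x ≤ h / L x₀ * L x₀ :=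
      mul_le_mul_of_nonneg_left h1 (by positivity)
    rw [div_mul_cancel₀ _ hpos.ne'] at h2
    linarith [hf0 x hx]
  have := hx₀ _ hmem
  rw [real_inner_smul_left, he, div_mul_cancel₀ _ hpos.ne'] at this
  exact lt_irrefl _ this

/-- A point at which all the slopes of `slopeSet` pair to less than `h` lies in the
sublevel set `{f ≤ h}`. -/
lemma le_of_inner_slopeSet_lt {Ω : Set (E n)} (hΩo : IsOpen Ω) (hΩc : Convex ℝ Ω)
    (h0 : (0 : E n) ∈ Ω) {f : E n → ℝ} (hf : ContinuousOn f (closure Ω))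
    (hfc : ConvexOn ℝ (closure Ω) f) (hf0 : ∀ x ∈ closure Ω, 0 ≤ f x) (hfz : f 0 = 0)
    {h : ℝ} (hh : 0 < h) {x₀ : E n} (hx : x₀ ∈ Ω)
    (hx₀ : ∀ ζ ∈ slopeSet (closure Ω) f h, ⟪ζ, x₀⟫ < h) : f x₀ ≤ h := by
  by_contra! hlt
  obtain ⟨ζ, hζ⟩ := exists_subgradient hΩo hf hfc hΩc hx
  set k := ⟪ζ, x₀⟫ - f x₀ with hk
  have hle : ∀ x ∈ closure Ω, ⟪ζ, x⟫ - k ≤ f x := by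
    intro x hx
    have := hζ x hx
    rw [inner_sub_right] at this
    linarith
  rcases le_or_gt k h with hkh | hkh
  · have := hx₀ ζ fun x hx => by linarith [hle x hx]
    have hk0 := hle 0 (subset_closure h0)
    rw [inner_zero_right, hfz] at hk0
    linarith
  · have hk0 : 0 < k := hh.trans hkh
    have hθ1 : h / k ≤ 1 := (div_le_one hk0).2 hkh.le
    have hθ0 : 0 < h / k := by positivity
    have hθk : h / k * k = h := div_mul_cancel₀ _ hk0.ne'
    have := hx₀ ((h / k) • ζ) fun x hx => by
      rw [real_inner_smul_left]
      have h1 := mul_le_mul_of_nonneg_left (hle x hx) hθ0.le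
      have h2 := mul_le_mul_of_nonneg_right hθ1 (hf0 x hx)
      nlinarith
    rw [real_inner_smul_left] at this
    nlinarith

/-- The positive quadratic form `x ↦ ∑ₖ ⟪ξₖ, x⟫²`. -/
def quadForm (ξ : Fin n → E n) (x : E n) : ℝ := ∑ k, ⟪ξ k, x⟫ ^ 2

lemma quadForm_nonneg (ξ : Fin n → E n) (x : E n) : 0 ≤ quadForm ξ x :=
  Finset.sum_nonneg fun _ _ => sq_nonneg _

lemma continuous_quadForm (ξ : Fin n → E n) : Continuous (quadForm ξ) := by
  unfold quadForm
  fun_prop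

lemma quadForm_smul (ξ : Fin n → E n) (c : ℝ) (x : E n) :
    quadForm ξ (c • x) = c ^ 2 * quadForm ξ x := by
  simp only [quadForm, inner_smul_right, mul_pow, Finset.mul_sum]

lemma sum_abs_inner_le (ξ : Fin n → E n) (x : E n) :
    ∑ k, |⟪ξ k, x⟫| ≤ n * √(quadForm ξ x) := by
  have : ∀ k ∈ Finset.univ, |⟪ξ k, x⟫| ≤ √(quadForm ξ x) := fun k hk =>
    Real.abs_le_sqrt (Finset.single_le_sum (f := fun k => ⟪ξ k, x⟫ ^ 2)
      (fun _ _ => sq_nonneg _) hk)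
  simpa using Finset.sum_le_sum this

lemma sqrt_quadForm_le (ξ : Fin n → E n) (x : E n) :
    √(quadForm ξ x) ≤ ∑ k, |⟪ξ k, x⟫| := by
  have h0 : 0 ≤ ∑ k, |⟪ξ k, x⟫| := Finset.sum_nonneg fun _ _ => abs_nonneg _
  rw [Real.sqrt_le_left h0]
  have := Finset.sum_sq_le_sq_sum_of_nonneg (s := Finset.univ) (f := fun k => |⟪ξ k, x⟫|)
    fun _ _ => abs_nonneg _
  simpa [quadForm] using this

/-- A function above the origin and the slopes `ξₖ` grows linearly after tilting by their mean. -/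
lemma mean_add_sqrt_le (ξ : Fin n → E n) (x : E n) {a : ℝ} (ha : 0 ≤ a)
    (hξ : ∀ k, ⟪ξ k, x⟫ ≤ a) :
    ⟪((n : ℝ) + 1)⁻¹ • ∑ k, ξ k, x⟫ + (((n : ℝ) + 1) ^ 2)⁻¹ * √(quadForm ξ x) ≤ a := by
  have hn : (0 : ℝ) ≤ n := Nat.cast_nonneg n
  have h1 : ∑ k, |⟪ξ k, x⟫| ≤ ∑ k : Fin n, (a + (a - ⟪ξ k, x⟫)) := by
    refine Finset.sum_le_sum fun k _ => ?_
    rw [abs_le]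
    constructor <;> linarith [hξ k]
  simp only [Finset.sum_add_distrib, Finset.sum_sub_distrib, Finset.sum_const, Finset.card_univ,
    Fintype.card_fin, nsmul_eq_mul] at h1
  have h2 := sqrt_quadForm_le ξ x
  have h3 : 0 ≤ n * a - ∑ k, ⟪ξ k, x⟫ := by
    have : ∑ k, ⟪ξ k, x⟫ ≤ ∑ _k : Fin n, a := Finset.sum_le_sum fun k _ => hξ k
    simp only [Finset.sum_const, Finset.card_univ, Fintype.card_fin, nsmul_eq_mul] at this
    linarith
  rw [real_inner_smul_left, sum_inner, inv_mul_eq_div, inv_mul_eq_div,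
    div_add_div _ _ (by positivity) (by positivity), div_le_iff₀ (by positivity)]
  set S := ∑ k, ⟪ξ k, x⟫
  have h4 : √(quadForm ξ x) ≤ (n + 1) * ((n + 1) * a - S) := by nlinarith [mul_nonneg hn h3]
  nlinarith

/-- Data of the two paraboloids adapted to `f` at height `h`. -/
structure BarrierData (Ω : Set (E n)) (f : E n → ℝ) (R b C ρ h : ℝ) where
  /-- The slopes of the quadratic form. -/
  ξ : Fin n → E n
  /-- The slope of the affine function above `f`. -/
  l : E n
  /-- The slope of the affine part of the paraboloid below `f`. -/
  m : E n
  det_ne_zero : (Matrix.of fun k i => ξ k i).det ≠ 0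
  mem_and_le : ∀ x, quadForm ξ x ≤ (ρ * h) ^ 2 → x ∈ Ω ∧ f x ≤ h + ⟪l, x⟫
  sub_le : ∀ x ∈ closure Ω, quadForm ξ x ≤ (R * h) ^ 2 →
    ⟪m, x⟫ + h / 2 + b / h * quadForm ξ x - C * h ≤ f x
  le_of_boundary : ∀ x ∈ closure Ω, quadForm ξ x ≤ (R * h) ^ 2 →
    (x ∉ Ω ∨ quadForm ξ x = (R * h) ^ 2) → ⟪m, x⟫ + h / 2 + b / h * quadForm ξ x ≤ f x

lemma exists_barrierData_of_nonneg {Ω : Set (E n)} (hΩo : IsOpen Ω) (hΩc : Convex ℝ Ω)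
    (hΩb : Bornology.IsBounded Ω) (h0 : (0 : E n) ∈ Ω) {f : E n → ℝ}
    (hf : ContinuousOn f (closure Ω)) (hfc : ConvexOn ℝ (closure Ω) f)
    (hf0 : ∀ x ∈ closure Ω, 0 ≤ f x) (hfz : f 0 = 0) {h₁ : ℝ} (hh₁ : 0 < h₁) (q : E n)
    (hq : ∀ x ∈ closure Ω, x ∉ Ω → h₁ + ⟪q, x⟫ ≤ f x) :
    ∃ R b C ρ hm : ℝ, 0 < R ∧ 0 < b ∧ 0 < C ∧ 0 < ρ ∧ 0 < hm ∧
      ∀ h, 0 < h → h ≤ hm → Nonempty (BarrierData Ω f R b C ρ h) := by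
  obtain ⟨M, hM, hΩM⟩ : ∃ M > 0, closure Ω ⊆ closedBall (0 : E n) M := by
    obtain ⟨M, hM⟩ := hΩb.closure.subset_closedBall (0 : E n)
    exact ⟨max M 1, by positivity, hM.trans (closedBall_subset_closedBall (le_max_left _ _))⟩
  set K := ‖q‖ * M with hK
  have hK0 : 0 ≤ K := by positivity
  have hqK : ∀ x ∈ closure Ω, |⟪q, x⟫| ≤ K := fun x hx =>
    (abs_real_inner_le_norm q x).trans
      (mul_le_mul_of_nonneg_left (mem_closedBall_zero_iff.1 (hΩM hx)) (norm_nonneg _))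
  set c : ℝ := (((n : ℝ) + 1) ^ 2)⁻¹ with hc
  have hc0 : 0 < c := by positivity
  set R := (4 + 4 * K / h₁) / c with hR
  have hR0 : 0 < R := by positivity
  have hcR : c * R = 4 + 4 * K / h₁ := by rw [hR]; field_simp
  set b := (2 * R ^ 2)⁻¹ with hb
  have hbR : b * R ^ 2 = 1 / 2 := by rw [hb]; field_simp
  have hb0 : 0 < b := by positivity
  refine ⟨R, b, 2 + 2 * K / h₁, ((n : ℝ) + 1)⁻¹, h₁ / 4, hR0, hb0, by positivity, by positivity,
    by positivity, fun h hh hhm => ?_⟩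
  obtain ⟨ξ, hξG, hdet, hdom⟩ := exists_dominating_basis
    (isCompact_slopeSet hΩo hΩb h0 hf h) (div_pos hh hM)
    (closedBall_subset_slopeSet hM hh.le hΩM hf0)
  set v := ((n : ℝ) + 1)⁻¹ • ∑ k, ξ k with hv
  set κ := 4 * h / h₁ with hκ
  have hκ0 : 0 < κ := by positivity
  have hκ1 : κ ≤ 1 := by rw [hκ, div_le_one hh₁]; linarith
  have hκh : κ * h₁ = 4 * h := div_mul_cancel₀ _ hh₁.ne'
  have hκK : κ * K = h * (4 * K / h₁) := by rw [hκ]; ring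
  have hlow : ∀ x ∈ closure Ω, ⟪v, x⟫ + c * √(quadForm ξ x) ≤ f x + h := fun x hx =>
    mean_add_sqrt_le ξ x (by linarith [hf0 x hx]) fun k => by linarith [hξG k x hx]
  have hq' : ∀ x ∈ closure Ω, |κ * ⟪q, x⟫| ≤ κ * K := fun x hx => by
    rw [abs_mul, abs_of_pos hκ0]
    exact mul_le_mul_of_nonneg_left (hqK x hx) hκ0.le
  have hm : ∀ x, ⟪(1 / 2 : ℝ) • (v + κ • q), x⟫ = (⟪v, x⟫ + κ * ⟪q, x⟫) / 2 := fun x => by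
    rw [real_inner_smul_left, inner_add_left, real_inner_smul_left q x κ]; ring
  have hquad : ∀ x, quadForm ξ x ≤ (R * h) ^ 2 → b / h * quadForm ξ x ≤ h / 2 := by
    intro x hx
    have h1 := mul_le_mul_of_nonneg_left hx (show 0 ≤ b / h by positivity)
    have h2 : b / h * (R * h) ^ 2 = (b * R ^ 2) * h := by field_simp
    rw [h2, hbR] at h1
    linarith
  refine ⟨⟨ξ, 0, (1 / 2 : ℝ) • (v + κ • q), hdet, fun x hx => ?_, fun x hx hxR => ?_,
    fun x hx hxR hxb => ?_⟩⟩
  · have hlt : ∀ ζ ∈ slopeSet (closure Ω) f h, ⟪ζ, x⟫ < h := by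
      intro ζ hζ
      have h1 := (le_abs_self _).trans ((hdom ζ hζ x).trans (sum_abs_inner_le ξ x))
      have h2 : √(quadForm ξ x) ≤ ((n : ℝ) + 1)⁻¹ * h := Real.sqrt_le_iff.2 ⟨by positivity, hx⟩
      have h3 := mul_le_mul_of_nonneg_left h2 (Nat.cast_nonneg (α := ℝ) n)
      have h4 : (n : ℝ) * (((n : ℝ) + 1)⁻¹ * h) < h := by
        rw [← mul_assoc, ← div_eq_mul_inv]
        have : (n : ℝ) / (n + 1) < 1 := (div_lt_one (by positivity)).2 (by linarith)
        nlinarith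
      linarith
    have hxΩ := mem_of_inner_slopeSet_lt hΩo hΩc h0 hf0 hh hlt
    refine ⟨hxΩ, ?_⟩
    have := le_of_inner_slopeSet_lt hΩo hΩc h0 hf hfc hf0 hfz hh hxΩ hlt
    simpa using this
  · have h1 := hlow x hx
    have h2 := abs_le.1 (hq' x hx)
    have h3 := hquad x hxR
    have h4 : 0 ≤ c * √(quadForm ξ x) := by positivity
    have h5 : 2 * K / h₁ * h = κ * K / 2 := by rw [hκK]; ring
    have h6 := hf0 x hx
    rw [hm, add_mul, h5]
    linarith [h2.1, h2.2]
  · have h1 := hlow x hx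
    have h2 := abs_le.1 (hq' x hx)
    have h3 := hquad x hxR
    have h4 : 0 ≤ c * √(quadForm ξ x) := by positivity
    have h6 := hf0 x hx
    rw [hm]
    rcases hxb with hxb | hxb
    · have h7 := mul_le_mul_of_nonneg_left (hq x hx hxb) hκ0.le
      have h8 : κ * f x ≤ f x := by nlinarith
      rw [mul_add, hκh] at h7
      linarith
    · have h7 : c * √(quadForm ξ x) = h * (4 + 4 * K / h₁) := by
        rw [hxb, Real.sqrt_sq (by positivity), ← mul_assoc, hcR]; ring
      rw [mul_add, ← hκK] at h7
      linarith

lemma exists_barrierData {Ω : Set (E n)} (hΩo : IsOpen Ω) (hΩc : Convex ℝ Ω)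
    (hΩb : Bornology.IsBounded Ω) (h0 : (0 : E n) ∈ Ω) {f : E n → ℝ}
    (hf : ContinuousOn f (closure Ω)) (hfc : ConvexOn ℝ (closure Ω) f)
    (hfz : f 0 = 0) {h₁ : ℝ} (hh₁ : 0 < h₁) (q : E n)
    (hq : ∀ x ∈ closure Ω, x ∉ Ω → h₁ + ⟪q, x⟫ ≤ f x) :
    ∃ R b C ρ hm : ℝ, 0 < R ∧ 0 < b ∧ 0 < C ∧ 0 < ρ ∧ 0 < hm ∧
      ∀ h, 0 < h → h ≤ hm → Nonempty (BarrierData Ω f R b C ρ h) := by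
  obtain ⟨ζ, hζ⟩ := exists_subgradient hΩo hf hfc hΩc h0
  simp only [hfz, sub_zero, zero_add] at hζ
  have hlin : ConcaveOn ℝ (closure Ω) fun x : E n => ⟪ζ, x⟫ :=
    (innerSL ℝ ζ).toLinearMap.concaveOn hΩc.closure
  obtain ⟨R, b, C, ρ, hm, hR, hb, hC, hρ, hhm, H⟩ := exists_barrierData_of_nonneg hΩo hΩc hΩb h0
    (f := fun x => f x - ⟪ζ, x⟫) (hf.sub (by fun_prop)) (hfc.sub hlin)
    (fun x hx => by linarith [hζ x hx]) (by simp [hfz]) hh₁ (q - ζ)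
    (fun x hx hx' => by rw [inner_sub_left]; linarith [hq x hx hx'])
  refine ⟨R, b, C, ρ, hm, hR, hb, hC, hρ, hhm, fun h hh hle => ?_⟩
  obtain ⟨ξ, l, m, h1, h2, h3, h4⟩ := H h hh hle
  refine ⟨⟨ξ, l + ζ, m + ζ, h1, fun x hx => ⟨(h2 x hx).1, ?_⟩, fun x hx hxR => ?_,
    fun x hx hxR hxb => ?_⟩⟩
  · rw [inner_add_left]; linarith [(h2 x hx).2]
  · rw [inner_add_left]; linarith [h3 x hx hxR]
  · rw [inner_add_left]; linarith [h4 x hx hxR hxb]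

/-- A paraboloid translating in time with constant speed `μ`. -/
def paraboloid (ξ : Fin n → E n) (m : E n) (a μ c : ℝ) (x : E n) (t : ℝ) : ℝ :=
  c + ⟪m, x⟫ + a * quadForm ξ x + μ * t

lemma continuous_paraboloid (ξ : Fin n → E n) (m : E n) (a μ c : ℝ) :
    Continuous fun z : E n × ℝ => paraboloid ξ m a μ c z.1 z.2 := by
  unfold paraboloid quadForm
  fun_prop

lemma isTestAt_paraboloid (ξ : Fin n → E n) (m : E n) (a μ c : ℝ) (x₀ : E n) (t₀ : ℝ) :
    IsTestAt (paraboloid ξ m a μ c) x₀ t₀ := by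
  refine ⟨1, one_pos, fun t _ => ?_, fun x _ => ?_⟩
  · have hin : ∀ w : E n, ContDiff ℝ 2 fun z : E n => ⟪w, z⟫ := fun w => (innerSL ℝ w).contDiff
    have hq : ContDiff ℝ 2 (quadForm ξ) := ContDiff.sum fun k _ => (hin (ξ k)).pow 2
    exact (((contDiff_const.add (hin m)).add (contDiff_const.mul hq)).add contDiff_const).contDiffOn
  · unfold paraboloid
    fun_prop

lemma timeDeriv_paraboloid (ξ : Fin n → E n) (m : E n) (a μ c : ℝ) (x₀ : E n) (t₀ : ℝ) :
    timeDeriv (paraboloid ξ m a μ c) x₀ t₀ = μ := by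
  have : HasDerivAt (paraboloid ξ m a μ c x₀) (μ * 1) t₀ :=
    ((hasDerivAt_id t₀).const_mul μ).const_add _
  simpa [timeDeriv] using this.deriv

lemma fderiv_paraboloid (ξ : Fin n → E n) (m : E n) (a μ c : ℝ) (y e : E n) (t : ℝ) :
    fderiv ℝ (fun z => paraboloid ξ m a μ c z t) y e =
      ⟪m, e⟫ + a * ∑ k, 2 * ⟪ξ k, e⟫ * ⟪ξ k, y⟫ := by
  have hin : ∀ w : E n, HasFDerivAt (fun z : E n => ⟪w, z⟫) (innerSL ℝ w) y := fun w =>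
    (innerSL ℝ w).hasFDerivAt
  have hq : HasFDerivAt (quadForm ξ) (∑ k, (2 * ⟪ξ k, y⟫) • innerSL ℝ (ξ k)) y := by
    refine HasFDerivAt.fun_sum fun k _ => ?_
    simpa using (hin (ξ k)).pow 2
  have := (((hin m).const_add c).add (hq.const_mul a)).add_const (μ * t)
  have h2 : fderiv ℝ (fun z => paraboloid ξ m a μ c z t) y = _ := this.fderiv
  rw [h2]
  simp only [add_apply, smul_apply, innerSL_apply_apply, smul_eq_mul, sum_apply]
  congr 2
  exact Finset.sum_congr rfl fun k _ => by ring

lemma hessMatrix_paraboloid (ξ : Fin n → E n) (m : E n) (a μ c : ℝ) (x₀ : E n) (t₀ : ℝ) :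
    hessMatrix (paraboloid ξ m a μ c) x₀ t₀ =
      (2 * a) • ((Matrix.of fun k i => ξ k i).transpose * Matrix.of fun k i => ξ k i) := by
  ext i j
  simp only [hessMatrix, Matrix.of_apply, fderiv_paraboloid]
  have hin : ∀ w : E n, HasFDerivAt (fun z : E n => ⟪w, z⟫) (innerSL ℝ w) x₀ := fun w =>
    (innerSL ℝ w).hasFDerivAt
  have h1 : HasFDerivAt (fun y : E n => ⟪m, EuclideanSpace.single j (1 : ℝ)⟫ +
      a * ∑ k, 2 * ⟪ξ k, EuclideanSpace.single j (1 : ℝ)⟫ * ⟪ξ k, y⟫)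
      (a • ∑ k, (2 * ⟪ξ k, EuclideanSpace.single j (1 : ℝ)⟫) • innerSL ℝ (ξ k)) x₀ :=
    ((HasFDerivAt.fun_sum fun k _ => (hin (ξ k)).const_mul _).const_mul a).const_add _
  rw [h1.fderiv]
  simp only [smul_apply, innerSL_apply_apply, smul_eq_mul, sum_apply,
    Matrix.smul_apply, Matrix.mul_apply, Matrix.transpose_apply, Matrix.of_apply,
    EuclideanSpace.inner_single_right, conj_trivial, one_mul, Finset.mul_sum]
  exact Finset.sum_congr rfl fun k _ => by ring

lemma det_hessMatrix_paraboloid (ξ : Fin n → E n) (m : E n) (a μ c : ℝ) (x₀ : E n) (t₀ : ℝ) :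
    (hessMatrix (paraboloid ξ m a μ c) x₀ t₀).det =
      (2 * a) ^ n * (Matrix.of fun k i => ξ k i).det ^ 2 := by
  rw [hessMatrix_paraboloid, Matrix.det_smul, Matrix.det_mul, Matrix.det_transpose,
    Fintype.card_fin, sq]

lemma posSemidef_hessMatrix_paraboloid (ξ : Fin n → E n) (m : E n) {a : ℝ} (ha : 0 ≤ a)
    (μ c : ℝ) (x₀ : E n) (t₀ : ℝ) :
    (hessMatrix (paraboloid ξ m a μ c) x₀ t₀).PosSemidef := by
  rw [hessMatrix_paraboloid]
  have := Matrix.posSemidef_conjTranspose_mul_self (Matrix.of fun k i => ξ k i)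
  rw [Matrix.conjTranspose_eq_transpose_of_trivial] at this
  exact this.smul (by positivity)

/-- A subsolution stays below a paraboloid that moves up fast enough. -/
lemma ViscSubsolution.le_paraboloid {Lam p : ℝ} {Ω : Set (E n)} {t₁ t₂ : ℝ} {u : E n → ℝ → ℝ}
    (hsub : ViscSubsolution Lam p Ω t₁ t₂ u)
    (hcont : ContinuousOn (fun q : E n × ℝ => u q.1 q.2) (closure Ω ×ˢ Icc t₁ t₂))
    {K U : Set (E n)} (hK : IsCompact K) (hKΩ : K ⊆ closure Ω) (hU : IsOpen U) (hUΩ : U ⊆ Ω)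
    (hUK : U ⊆ K) {s t : ℝ} (hs : t₁ ≤ s) (ht : t ≤ t₂)
    {ξ : Fin n → E n} {m : E n} {a μ c : ℝ} (ha : 0 ≤ a)
    (hμ : Lam * ((2 * a) ^ n * (Matrix.of fun k i => ξ k i).det ^ 2) ^ p < μ)
    (hinit : ∀ x ∈ K, u x s ≤ paraboloid ξ m a μ c x s)
    (hbdry : ∀ x ∈ K, x ∉ U → ∀ τ ∈ Icc s t, u x τ ≤ paraboloid ξ m a μ c x τ) :
    ∀ x ∈ K, ∀ τ ∈ Icc s t, u x τ ≤ paraboloid ξ m a μ c x τ := by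
  intro x hx τ hτ
  have hsubset : K ×ˢ Icc s t ⊆ closure Ω ×ˢ Icc t₁ t₂ :=
    prod_mono hKΩ (Icc_subset_Icc hs ht)
  obtain ⟨⟨x₁, τ₁⟩, ⟨hx₁, hτ₁⟩, hmax⟩ := (hK.prod (isCompact_Icc (a := s) (b := t))).exists_isMaxOn
    ⟨(x, τ), hx, hτ⟩ ((hcont.mono hsubset).sub (continuous_paraboloid ξ m a μ c).continuousOn)
  have hmax' : ∀ y ∈ K, ∀ σ ∈ Icc s t, u y σ - paraboloid ξ m a μ c y σ ≤
      u x₁ τ₁ - paraboloid ξ m a μ c x₁ τ₁ := fun y hy σ hσ => hmax (Set.mk_mem_prod hy hσ)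
  simp only at hx₁ hτ₁
  have hle : u x₁ τ₁ ≤ paraboloid ξ m a μ c x₁ τ₁ := by
    by_cases hsτ : τ₁ = s
    · rw [hsτ]; exact hinit x₁ hx₁
    by_cases hxU : x₁ ∉ U
    · exact hbdry x₁ hx₁ hxU τ₁ hτ₁
    push Not at hxU
    have hslt : s < τ₁ := lt_of_le_of_ne hτ₁.1 (Ne.symm hsτ)
    exfalso
    obtain ⟨r, hr, hball⟩ := Metric.isOpen_iff.1 hU x₁ hxU
    have h1 := hsub x₁ (hUΩ hxU) τ₁ ⟨hs.trans_lt hslt, hτ₁.2.trans ht⟩ _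
      (isTestAt_paraboloid ξ m a μ c x₁ τ₁) ⟨min r (τ₁ - s), lt_min hr (sub_pos.2 hslt),
        fun y _ σ _ hσ hyd hσd => by
          have hyU : y ∈ U := hball (hyd.trans_le (min_le_left _ _))
          refine hmax' y (hUK hyU) σ ⟨?_, hσ.trans hτ₁.2⟩
          have h2 := hσd.trans_le (min_le_right _ _)
          rw [Real.dist_eq, abs_lt] at h2
          linarith [h2.1]⟩
    rw [timeDeriv_paraboloid, det_hessMatrix_paraboloid, max_eq_left (by positivity)] at h1
    linarith
  linarith [hmax' x hx τ hτ]

/-- A supersolution stays above a paraboloid that moves up slowly enough. -/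
lemma ViscSupersolution.paraboloid_le {lam p : ℝ} {Ω : Set (E n)} {t₁ t₂ : ℝ} {u : E n → ℝ → ℝ}
    (hsup : ViscSupersolution lam p Ω t₁ t₂ u)
    (hcont : ContinuousOn (fun q : E n × ℝ => u q.1 q.2) (closure Ω ×ˢ Icc t₁ t₂))
    {K U : Set (E n)} (hK : IsCompact K) (hKΩ : K ⊆ closure Ω) (hU : IsOpen U) (hUΩ : U ⊆ Ω)
    (hUK : U ⊆ K) {s t : ℝ} (hs : t₁ ≤ s) (ht : t ≤ t₂)
    {ξ : Fin n → E n} {m : E n} {a μ c : ℝ} (ha : 0 ≤ a)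
    (hμ : μ < lam * ((2 * a) ^ n * (Matrix.of fun k i => ξ k i).det ^ 2) ^ p)
    (hinit : ∀ x ∈ K, paraboloid ξ m a μ c x s ≤ u x s)
    (hbdry : ∀ x ∈ K, x ∉ U → ∀ τ ∈ Icc s t, paraboloid ξ m a μ c x τ ≤ u x τ) :
    ∀ x ∈ K, ∀ τ ∈ Icc s t, paraboloid ξ m a μ c x τ ≤ u x τ := by
  intro x hx τ hτ
  have hsubset : K ×ˢ Icc s t ⊆ closure Ω ×ˢ Icc t₁ t₂ :=
    prod_mono hKΩ (Icc_subset_Icc hs ht)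
  obtain ⟨⟨x₁, τ₁⟩, ⟨hx₁, hτ₁⟩, hmin⟩ := (hK.prod (isCompact_Icc (a := s) (b := t))).exists_isMinOn
    ⟨(x, τ), hx, hτ⟩ ((hcont.mono hsubset).sub (continuous_paraboloid ξ m a μ c).continuousOn)
  have hmin' : ∀ y ∈ K, ∀ σ ∈ Icc s t, u x₁ τ₁ - paraboloid ξ m a μ c x₁ τ₁ ≤
      u y σ - paraboloid ξ m a μ c y σ := fun y hy σ hσ => hmin (Set.mk_mem_prod hy hσ)
  simp only at hx₁ hτ₁
  have hle : paraboloid ξ m a μ c x₁ τ₁ ≤ u x₁ τ₁ := by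
    by_cases hsτ : τ₁ = s
    · rw [hsτ]; exact hinit x₁ hx₁
    by_cases hxU : x₁ ∉ U
    · exact hbdry x₁ hx₁ hxU τ₁ hτ₁
    push Not at hxU
    have hslt : s < τ₁ := lt_of_le_of_ne hτ₁.1 (Ne.symm hsτ)
    exfalso
    obtain ⟨r, hr, hball⟩ := Metric.isOpen_iff.1 hU x₁ hxU
    have h1 := hsup x₁ (hUΩ hxU) τ₁ ⟨hs.trans_lt hslt, hτ₁.2.trans ht⟩ _
      (isTestAt_paraboloid ξ m a μ c x₁ τ₁) ⟨min r (τ₁ - s), lt_min hr (sub_pos.2 hslt),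
        fun y _ σ _ hσ hyd hσd => by
          have hyU : y ∈ U := hball (hyd.trans_le (min_le_left _ _))
          refine hmin' y (hUK hyU) σ ⟨?_, hσ.trans hτ₁.2⟩
          have h2 := hσd.trans_le (min_le_right _ _)
          rw [Real.dist_eq, abs_lt] at h2
          linarith [h2.1]⟩ (posSemidef_hessMatrix_paraboloid ξ m ha μ c x₁ τ₁)
    rw [timeDeriv_paraboloid, det_hessMatrix_paraboloid] at h1
    linarith
  linarith [hmin' x hx τ hτ]

lemma quadForm_zero (ξ : Fin n → E n) : quadForm ξ 0 = 0 := by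
  simp [quadForm]

lemma eq_zero_of_quadForm_eq_zero {ξ : Fin n → E n} (hdet : (Matrix.of fun k i => ξ k i).det ≠ 0)
    {x : E n} (hx : quadForm ξ x = 0) : x = 0 := by
  have h1 : ∀ k, ⟪ξ k, x⟫ = 0 := fun k => by
    have := (Finset.sum_eq_zero_iff_of_nonneg fun k _ => sq_nonneg ⟪ξ k, x⟫).1 hx k
      (Finset.mem_univ k)
    exact pow_eq_zero_iff two_ne_zero |>.1 this
  have h2 := Matrix.eq_zero_of_mulVec_eq_zero hdet (v := x.ofLp) <| by
    ext k
    have := h1 k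
    simp only [PiLp.inner_apply, RCLike.inner_apply, conj_trivial] at this
    simpa [Matrix.mulVec, dotProduct, mul_comm] using this
  ext i
  exact congrFun h2 i

/-- If `u(0, ·)` rises from `-2h` to `0` before the time `t₀`, the rise takes a time controlled
from below by the paraboloid above `u(·, t₀)`. -/
lemma half_height_le_of_subsolution {Lam p : ℝ} (hLam : 0 < Lam) {Ω : Set (E n)}
    (hΩb : Bornology.IsBounded Ω) (hh0 : (0 : E n) ∈ Ω) {t₁ t₂ : ℝ} {u : E n → ℝ → ℝ}
    (hreg : ParabolicRegular Ω t₁ t₂ u) (hsub : ViscSubsolution Lam p Ω t₁ t₂ u)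
    {R b C ρ h t₀ : ℝ} (D : BarrierData Ω (fun x => u x t₀) R b C ρ h) (hρ : 0 < ρ) (hh : 0 < h)
    {s t : ℝ} (hs : t₁ ≤ s) (hst : s < t) (htt : t ≤ t₀) (ht₀ : t₀ ≤ t₂)
    (hus : u 0 s = -(2 * h)) (hut : u 0 t = 0) :
    h / 2 ≤ Lam * ((3 * h / (ρ * h) ^ 2) ^ n * (Matrix.of fun k i => D.ξ k i).det ^ 2) ^ p
      * (t - s) := by
  by_contra! hlt
  have hts : 0 < t - s := sub_pos.2 hst
  obtain ⟨μ, hμ1, hμ2⟩ := exists_between ((lt_div_iff₀ hts).2 hlt)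
  rw [lt_div_iff₀ hts] at hμ2
  have hρh : 0 < ρ * h := by positivity
  set a := 3 * h / 2 / (ρ * h) ^ 2 with ha
  have ha0 : 0 ≤ a := by positivity
  have h2a : 2 * a = 3 * h / (ρ * h) ^ 2 := by rw [ha]; ring
  have haρ : a * (ρ * h) ^ 2 = 3 * h / 2 := div_mul_cancel₀ _ (by positivity)
  have hμ0 : 0 ≤ μ := le_trans (by positivity) hμ1.le
  rw [← h2a] at hμ1
  set K := {x | quadForm D.ξ x ≤ (ρ * h) ^ 2} with hKdef
  have hKΩ : K ⊆ Ω := fun x hx => (D.mem_and_le x hx).1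
  have hK : IsCompact K := isCompact_of_isClosed_isBounded
    (isClosed_le (continuous_quadForm _) continuous_const) (hΩb.subset hKΩ)
  have hbefore : ∀ x ∈ K, ∀ τ, t₁ ≤ τ → τ ≤ t₀ → u x τ ≤ h + ⟪D.l, x⟫ := fun x hx τ h1 h2 =>
    (hreg.mono x (subset_closure (hKΩ hx)) τ ⟨h1, h2.trans ht₀⟩ t₀ ⟨h1.trans h2, ht₀⟩ h2).trans
      (D.mem_and_le x hx).2
  have hmain := hsub.le_paraboloid (m := D.l) (c := h - 3 * h / 2 - μ * s)
    hreg.cont hK (hKΩ.trans subset_closure)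
    (U := {x | quadForm D.ξ x < (ρ * h) ^ 2})
    (isOpen_lt (continuous_quadForm _) continuous_const)
    (fun x hx => hKΩ (le_of_lt (mem_ofPred_eq ▸ hx))) (fun x hx => le_of_lt (mem_ofPred_eq ▸ hx))
    hs (htt.trans ht₀) ha0 hμ1 ?_ ?_ 0 ?_ t ⟨hst.le, le_rfl⟩
  · rw [hut, paraboloid, inner_zero_right, quadForm_zero] at hmain
    linarith
  · intro x hx
    have hxK : quadForm D.ξ x ≤ (ρ * h) ^ 2 := hx
    set r := √(quadForm D.ξ x) / (ρ * h) with hr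
    have hr0 : 0 ≤ r := by positivity
    have hrN : quadForm D.ξ x = (ρ * h) ^ 2 * r ^ 2 := by
      rw [hr, div_pow, Real.sq_sqrt (quadForm_nonneg _ _)]
      field_simp
    have hr1 : r ≤ 1 := by
      rw [hr, div_le_one hρh]
      exact Real.sqrt_le_iff.2 ⟨hρh.le, hxK⟩
    have hcone : u x s ≤ ⟪D.l, x⟫ + r * h - (1 - r) * (2 * h) := by
      rcases hr0.eq_or_lt with hr' | hr'
      · have hx0 : x = 0 := eq_zero_of_quadForm_eq_zero D.det_ne_zero (by rw [hrN, ← hr']; ring)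
        rw [← hr', hx0, hus, inner_zero_right]
        linarith
      · have hyK : r⁻¹ • x ∈ K := by
          rw [hKdef, mem_ofPred_eq, quadForm_smul, hrN]
          apply le_of_eq
          field_simp
        have hconv := (hreg.conv s ⟨hs, by linarith⟩).2 (subset_closure (hKΩ hyK))
          (subset_closure hh0) hr0 (sub_nonneg.2 hr1) (by ring)
        have h1 := hbefore _ hyK s hs (by linarith)
        simp only [smul_smul, mul_inv_cancel₀ hr'.ne', one_smul, smul_zero, add_zero,
          smul_eq_mul, hus] at hconv
        rw [real_inner_smul_right] at h1
        have h2 := mul_le_mul_of_nonneg_left h1 hr0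
        rw [mul_add, ← mul_assoc, mul_inv_cancel₀ hr'.ne', one_mul] at h2
        linarith
    have h3 : a * quadForm D.ξ x = 3 * h / 2 * r ^ 2 := by rw [hrN, ← mul_assoc, haρ]
    rw [paraboloid, h3]
    nlinarith [mul_nonneg hh.le (sq_nonneg (1 - r))]
  · intro x hx hxU τ hτ
    have h1 : quadForm D.ξ x = (ρ * h) ^ 2 := le_antisymm hx (not_lt.1 hxU)
    have h2 := hbefore x hx τ (hs.trans hτ.1) (hτ.2.trans htt)
    have h3 := mul_nonneg hμ0 (sub_nonneg.2 hτ.1)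
    rw [paraboloid, h1, haρ]
    linarith
  · rw [hKdef, mem_ofPred_eq, quadForm_zero]
    positivity

/-- If `u(0, ·)` stays nonpositive during `[t₀, t]`, the determinant of the paraboloid below
`u(·, t₀)` is controlled from above. -/
lemma det_le_of_supersolution {lam p : ℝ} {Ω : Set (E n)}
    (hΩo : IsOpen Ω) (hΩb : Bornology.IsBounded Ω) (hh0 : (0 : E n) ∈ Ω) {t₁ t₂ : ℝ}
    {u : E n → ℝ → ℝ}
    (hreg : ParabolicRegular Ω t₁ t₂ u) (hsup : ViscSupersolution lam p Ω t₁ t₂ u)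
    {R b C ρ h t₀ : ℝ} (D : BarrierData Ω (fun x => u x t₀) R b C ρ h) (hb : 0 < b)
    (hC : 0 < C) (hh : 0 < h)
    {t : ℝ} (ht₀ : t₁ ≤ t₀) (htt : t₀ < t) (ht : t ≤ t₂) (hut : u 0 t ≤ 0) :
    lam * ((2 * (b / h)) ^ n * (Matrix.of fun k i => D.ξ k i).det ^ 2) ^ p ≤
      C * h / (t - t₀) := by
  by_contra! hlt
  have hts : 0 < t - t₀ := sub_pos.2 htt
  set μ := C * h / (t - t₀) with hμ
  have hμt : μ * (t - t₀) = C * h := div_mul_cancel₀ _ hts.ne'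
  have hμ0 : 0 ≤ μ := by positivity
  set K := closure Ω ∩ {x | quadForm D.ξ x ≤ (R * h) ^ 2} with hKdef
  have hK : IsCompact K := hΩb.isCompact_closure.inter_right
    (isClosed_le (continuous_quadForm _) continuous_const)
  have hmain := hsup.paraboloid_le (m := D.m) (c := h / 2 - C * h - μ * t₀)
    hreg.cont hK inter_subset_left
    (U := Ω ∩ {x | quadForm D.ξ x < (R * h) ^ 2})
    (hΩo.inter (isOpen_lt (continuous_quadForm _) continuous_const)) inter_subset_left
    (fun x hx => ⟨subset_closure hx.1, le_of_lt (mem_ofPred_eq ▸ hx.2)⟩)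
    ht₀ ht (by positivity) hlt ?_ ?_ 0 ?_ t ⟨htt.le, le_rfl⟩
  · rw [paraboloid, inner_zero_right, quadForm_zero] at hmain
    linarith
  · intro x hx
    have := D.sub_le x hx.1 hx.2
    rw [paraboloid]
    linarith
  · intro x hx hxU τ hτ
    have h1 := D.le_of_boundary x hx.1 hx.2 <| by
      by_contra! hcon
      exact hxU ⟨hcon.1, lt_of_le_of_ne hx.2 hcon.2⟩
    have h2 := hreg.mono x hx.1 t₀ ⟨ht₀, htt.le.trans ht⟩ τ ⟨ht₀.trans hτ.1, hτ.2.trans ht⟩ hτ.1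
    have h3 := mul_le_mul_of_nonneg_left (sub_le_sub_right hτ.2 t₀) hμ0
    rw [paraboloid]
    linarith
  · refine ⟨subset_closure hh0, ?_⟩
    rw [mem_ofPred_eq, quadForm_zero]
    positivity

/-- The compact section at the final time keeps `u` away from an affine function on the boundary
shortly before. -/
lemma exists_boundary_gap {Ω : Set (E n)} (hΩb : Bornology.IsBounded Ω)
    {T δ : ℝ} (hδ0 : 0 < δ) (hδT : δ < T) {u : E n → ℝ → ℝ}
    (hcont : ContinuousOn (fun q : E n × ℝ => u q.1 q.2) (closure Ω ×ˢ Icc (-T) 0))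
    {h₀ : ℝ} (hh₀ : 0 < h₀) {q : E n} (hsec : closure {x ∈ Ω | u x 0 < h₀ + ⟪q, x⟫} ⊆ Ω) :
    ∃ ε, 0 < ε ∧ ε ≤ δ ∧ ∀ x ∈ closure Ω, x ∉ Ω → h₀ / 2 + ⟪q, x⟫ ≤ u x (-ε) := by
  have hT : (0 : ℝ) ∈ Icc (-T) 0 := ⟨by linarith, le_rfl⟩
  have hfinal : ∀ x ∈ closure Ω, x ∉ Ω → h₀ + ⟪q, x⟫ ≤ u x 0 := by
    intro x hx hxΩ
    by_contra! hlt
    have h1 : ContinuousOn (fun y => u y 0 - (h₀ + ⟪q, y⟫)) (closure Ω) :=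
      (hcont.comp (f := fun y : E n => (y, (0 : ℝ))) (by fun_prop) fun y hy => ⟨hy, hT⟩).sub
        (by fun_prop)
    have h2 : ∀ᶠ y in nhdsWithin x (closure Ω), u y 0 - (h₀ + ⟪q, y⟫) < 0 :=
      (h1 x hx).eventually (gt_mem_nhds (by linarith))
    apply hxΩ
    apply hsec
    rw [mem_closure_iff_frequently]
    have h3 := mem_closure_iff_frequently.1 hx
    rw [eventually_nhdsWithin_iff] at h2
    exact (h3.and_eventually h2).mono fun y hy => ⟨hy.1, by linarith [hy.2 (subset_closure hy.1)]⟩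
  have huc := (hΩb.isCompact_closure.prod isCompact_Icc).uniformContinuousOn_of_continuous hcont
  obtain ⟨r, hr, hur⟩ := Metric.uniformContinuousOn_iff.1 huc (h₀ / 2) (by positivity)
  refine ⟨min δ (r / 2), by positivity, min_le_left _ _, fun x hx hxΩ => ?_⟩
  have hmin0 : 0 < min δ (r / 2) := by positivity
  have hmin1 := min_le_left δ (r / 2)
  have hmin2 := min_le_right δ (r / 2)
  have h1 := hur (x, 0) ⟨hx, hT⟩ (x, -min δ (r / 2)) ⟨hx, by constructor <;> simp only <;> linarith⟩
    (by
      rw [Prod.dist_eq, dist_self, Real.dist_eq, sub_neg_eq_add, zero_add, abs_of_pos hmin0]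
      exact max_lt hr (by linarith))
  rw [Real.dist_eq, abs_lt] at h1
  simp only at h1
  linarith [hfinal x hx hxΩ, h1.2]

/-- A lower bound for the time `u(0, ·)` needs to rise from a slightly negative value to zero. -/
lemma exists_time_gap {p lam Lam : ℝ} (hlam : 0 < lam) (hLam : 0 < Lam)
    {Ω : Set (E n)} {u : E n → ℝ → ℝ} (hΩo : IsOpen Ω) (hΩc : Convex ℝ Ω)
    (hΩb : Bornology.IsBounded Ω) {t₁ t₀ t₂ : ℝ} (ht₁ : t₁ ≤ t₀) (ht₂ : t₀ < t₂)
    (hu : ViscositySolution lam Lam p Ω t₁ t₂ u) (h0 : (0 : E n) ∈ Ω)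
    (hu₀ : u 0 t₀ = 0) (hu₂ : u 0 t₂ = 0) {h₁ : ℝ} (hh₁ : 0 < h₁) (q : E n)
    (hq : ∀ x ∈ closure Ω, x ∉ Ω → h₁ + ⟪q, x⟫ ≤ u x t₀) :
    ∃ hm B : ℝ, 0 < hm ∧ 0 < B ∧ ∀ s t, t₁ ≤ s → s < t → t ≤ t₀ → u 0 s < 0 →
      -hm ≤ u 0 s → u 0 t = 0 → 1 ≤ B * (t - s) := by
  obtain ⟨hreg, hsub, hsup⟩ := hu
  have hmem : t₀ ∈ Icc t₁ t₂ := ⟨ht₁, ht₂.le⟩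
  obtain ⟨R, b, C, ρ, hm, -, hb, hC, hρ, hhm, H⟩ := exists_barrierData hΩo hΩc hΩb h0
    (f := fun x => u x t₀)
    (hreg.cont.comp (f := fun y : E n => (y, t₀)) (by fun_prop) fun y hy => ⟨hy, hmem⟩)
    (hreg.conv t₀ hmem) hu₀ hh₁ q hq
  have hε : 0 < t₂ - t₀ := sub_pos.2 ht₂
  set k := 3 / (2 * b * ρ ^ 2) with hk
  have hk0 : 0 < k := by positivity
  refine ⟨hm, 2 * (Lam * (k ^ n) ^ p * (C / (lam * (t₂ - t₀)))), hhm, by positivity,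
    fun s t hs hst htt hus hus' hut => ?_⟩
  set h := -u 0 s / 2 with hh
  have hh0 : 0 < h := by linarith
  obtain ⟨D⟩ := H h hh0 (by linarith)
  have hup := half_height_le_of_subsolution hLam hΩb h0 hreg hsub D hρ hh0 hs hst htt ht₂.le
    (by rw [hh]; ring) hut
  have hlow := det_le_of_supersolution hΩo hΩb h0 hreg hsup D hb hC hh0 ht₁ ht₂ le_rfl hu₂.le
  set d := (Matrix.of fun k i => D.ξ k i).det
  have hcoef : (3 * h / (ρ * h) ^ 2) ^ n * d ^ 2 = k ^ n * ((2 * (b / h)) ^ n * d ^ 2) := by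
    rw [← mul_assoc, ← mul_pow]
    congr 2
    rw [hk]
    field_simp
  rw [hcoef, Real.mul_rpow (by positivity) (by positivity)] at hup
  set Q := ((2 * (b / h)) ^ n * d ^ 2) ^ p
  have hQ : Q ≤ C / (lam * (t₂ - t₀)) * h := by
    rw [le_div_iff₀ hε] at hlow
    rw [div_mul_eq_mul_div, le_div_iff₀ (by positivity)]
    linarith
  have hts : 0 < t - s := sub_pos.2 hst
  have h1 : Lam * ((k ^ n) ^ p * Q) * (t - s) ≤
      Lam * ((k ^ n) ^ p * (C / (lam * (t₂ - t₀)) * h)) * (t - s) := by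
    gcongr
  refine le_of_mul_le_mul_right ?_ hh0
  linarith

/-- Theorem 5.2: a constant segment in time extends backwards in time. -/
theorem stmt7 (n : ℕ) (p lam Lam : ℝ)
    (hp : 0 < p) (hlam : 0 < lam) (hll : lam ≤ Lam)
    (Ω : Set (E n)) (T δ : ℝ) (u : E n → ℝ → ℝ)
    (hΩo : IsOpen Ω) (hΩc : Convex ℝ Ω) (hΩb : Bornology.IsBounded Ω)
    (hT : 0 < T) (hδ0 : 0 < δ) (hδT : δ < T)
    (hu : ViscositySolution lam Lam p Ω (-T) 0 u)
    (h0 : (0 : E n) ∈ Ω)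
    (hconst : ∀ t ∈ Icc (-δ) 0, u 0 t = 0)
    (hsec : ∃ h₀ : ℝ, 0 < h₀ ∧ ∃ q : E n,
      IsCompact (closure {x ∈ Ω | u x 0 < h₀ + ⟪q, x⟫}) ∧
      closure {x ∈ Ω | u x 0 < h₀ + ⟪q, x⟫} ⊆ Ω) :
    ∀ t ∈ Icc (-T) 0, u 0 t = 0 := by
  obtain ⟨h₀, hh₀, q, -, hsec⟩ := hsec
  have hreg := hu.1
  have hz : (0 : E n) ∈ closure Ω := subset_closure h0
  obtain ⟨ε, hε0, hεδ, hgap⟩ := exists_boundary_gap hΩb hδ0 hδT hreg.cont hh₀ hsec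
  have h00 : u 0 0 = 0 := hconst 0 ⟨by linarith, le_rfl⟩
  obtain ⟨hm, B, hhm, hB, hrise⟩ := exists_time_gap hlam (hlam.trans_le hll) hΩo hΩc hΩb
    (by linarith : -T ≤ -ε) (by linarith) hu h0 (hconst _ ⟨by linarith, by linarith⟩) h00
    (half_pos hh₀) q hgap
  have hut : ContinuousOn (u 0) (Icc (-T) 0) :=
    hreg.cont.comp (f := fun t : ℝ => ((0 : E n), t)) (by fun_prop) fun t ht => ⟨hz, ht⟩
  have hle : ∀ t ∈ Icc (-T) 0, u 0 t ≤ 0 := fun t ht =>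
    (hreg.mono 0 hz t ht 0 ⟨by linarith, le_rfl⟩ ht.2).trans h00.le
  have hcpt : IsCompact (Icc (-T) 0 ∩ u 0 ⁻¹' {0}) :=
    isCompact_Icc.of_isClosed_subset (hut.preimage_isClosed_of_isClosed isClosed_Icc
      isClosed_singleton) inter_subset_left
  obtain ⟨t₁, ⟨ht₁, hut₁⟩, hleast⟩ := hcpt.exists_isLeast ⟨0, ⟨by linarith, le_rfl⟩, h00⟩
  have hut₁ : u 0 t₁ = 0 := hut₁
  have ht₁δ : t₁ ≤ -δ :=
    hleast ⟨⟨by linarith, by linarith⟩, hconst _ ⟨le_rfl, by linarith⟩⟩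
  have ht₁T : t₁ = -T := by
    by_contra hne
    have hlt : -T < t₁ := lt_of_le_of_ne ht₁.1 (Ne.symm hne)
    obtain ⟨r, hr, hur⟩ := Metric.continuousOn_iff.1 hut t₁ ht₁ hm hhm
    set w := min (min r B⁻¹) (t₁ + T) / 2 with hw
    have hmin0 : 0 < min (min r B⁻¹) (t₁ + T) :=
      lt_min (lt_min hr (inv_pos.2 hB)) (by linarith)
    have hw0 : 0 < w := half_pos hmin0
    have hwmin : w < min (min r B⁻¹) (t₁ + T) := half_lt_self hmin0
    have hwT : w < t₁ + T := hwmin.trans_le (min_le_right _ _)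
    have hwr : w < r := hwmin.trans_le ((min_le_left _ _).trans (min_le_left _ _))
    have hwB : w < B⁻¹ := hwmin.trans_le ((min_le_left _ _).trans (min_le_right _ _))
    have hs : t₁ - w ∈ Icc (-T) 0 := ⟨by linarith, by linarith⟩
    have hneg : u 0 (t₁ - w) < 0 := lt_of_le_of_ne (hle _ hs) fun h => by
      have := hleast ⟨hs, h⟩
      linarith
    have hclose := hur (t₁ - w) hs (by
      rw [Real.dist_eq, sub_sub_cancel_left, abs_neg, abs_of_pos hw0]
      exact hwr)
    rw [hut₁, Real.dist_eq, sub_zero, abs_lt] at hclose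
    have h1 := hrise (t₁ - w) t₁ hs.1 (by linarith) (by linarith) hneg hclose.1.le hut₁
    rw [sub_sub_cancel] at h1
    have h2 := mul_lt_mul_of_pos_left hwB hB
    rw [mul_inv_cancel₀ hB.ne'] at h2
    linarith
  intro t ht
  refine le_antisymm (hle t ht) ?_
  rw [← hut₁]
  exact hreg.mono 0 hz t₁ ht₁ t ht (ht₁T ▸ ht.1)
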